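/- arXiv:0712.0125 — 15 statements merged into one kernel-verified Lean document; each statement's English description precedes it below -/
import Mathlib

section
/- Let k be a field, (S,·) a semigroup and f : S → k a function. Then the family of right shifts (f_s)_{s∈S} has finite rank in k^S if and only if the family of left shifts (ₛf)_{s∈S} has finite rank in k^S. -/
/-- If the rows of a (possibly infinite) matrix over a field span a finite-dimensional space,
then so do its columns. -/
theorem finiteDimensional_span_range_flip {k A B : Type*} [Field k] (g : A → B → k)
    (h : FiniteDimensional k (Submodule.span k (Set.range g))) :
    FiniteDimensional k (Submodule.span k (Set.range fun b a => g a b)) := by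
  let row (a : A) : Submodule.span k (Set.range g) :=
    ⟨g a, Submodule.subset_span ⟨a, rfl⟩⟩
  let evalRows : Module.Dual k (Submodule.span k (Set.range g)) →ₗ[k] (A → k) :=
    LinearMap.pi fun a => Module.Dual.eval k _ (row a)
  have hle : Submodule.span k (Set.range fun b a => g a b) ≤ LinearMap.range evalRows := by
    rw [Submodule.span_le]
    rintro _ ⟨b, rfl⟩
    exact ⟨(LinearMap.proj b).comp (Submodule.subtype _), rfl⟩
  exact Submodule.finiteDimensional_of_le hle


/-- Let `k` be a field, `(S, ·)` a semigroup and `f : S → k`.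
The family of right shifts `(f_s)_{s ∈ S}`, `f_s x = f (s * x)`, has finite rank in `k^S`
iff the family of left shifts `(ₛf)_{s ∈ S}`, `ₛf x = f (x * s)`, has finite rank in `k^S`. -/
theorem right_shifts_finite_rank_iff_left_shifts_finite_rank
    {k S : Type*} [Field k] [Semigroup S] (f : S → k) :
    FiniteDimensional k ↥(Submodule.span k (Set.range fun s : S => fun x : S => f (s * x))) ↔
    FiniteDimensional k ↥(Submodule.span k (Set.range fun s : S => fun x : S => f (x * s))) := by
  exact ⟨finiteDimensional_span_range_flip fun s x => f (s * x),
    finiteDimensional_span_range_flip fun s x => f (x * s)⟩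
end

section
/- Let k be a field, (S,·) a semigroup and f : S → k a function. Then the family of right shifts (f_s)_{s∈S} has finite rank in k^S if and only if there exist n ∈ ℕ and functions g₁,…,gₙ, h₁,…,hₙ : S → k such that f(x·y) = Σ_{i=1}^n gᵢ(x)·hᵢ(y) for all x, y ∈ S. -/
/-- Let `k` be a field, `(S, ·)` a semigroup and `f : S → k`.
The family of right shifts `(f_s)_{s ∈ S}` has finite rank in `k^S` iff there are finitely
many functions `g₁, …, gₙ, h₁, …, hₙ : S → k` with `f (x * y) = ∑ i, gᵢ x * hᵢ y`. -/
theorem right_shifts_finite_rank_iff_finite_decomposition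
    {k S : Type*} [Field k] [Semigroup S] (f : S → k) :
    FiniteDimensional k ↥(Submodule.span k (Set.range fun s : S => fun x : S => f (s * x))) ↔
    ∃ (n : ℕ) (g h : Fin n → S → k), ∀ x y : S, f (x * y) = ∑ i, g i x * h i y := by
  constructor
  · intro hfin
    set V := Submodule.span k (Set.range fun s : S => fun x : S => f (s * x))
    let b := Module.finBasis k V
    let shift : S → V := fun s => ⟨fun x => f (s * x), Submodule.subset_span ⟨s, rfl⟩⟩
    refine ⟨Module.finrank k V, fun i x => b.repr (shift x) i, fun i => (b i : S → k), ?_⟩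
    intro x y
    have hsum : f (x * y) = ((∑ i, b.repr (shift x) i • b i : V) : S → k) y := by
      rw [b.sum_repr]
    rw [hsum]
    simp only [Submodule.coe_sum, Submodule.coe_smul, Finset.sum_apply, Pi.smul_apply,
      smul_eq_mul]
  · rintro ⟨n, g, h, hf⟩
    have hle : Submodule.span k (Set.range fun s : S => fun x : S => f (s * x)) ≤
        Submodule.span k (Set.range h) := by
      rw [Submodule.span_le]
      rintro _ ⟨s, rfl⟩
      have hs : (fun x : S => f (s * x)) = ∑ i, g i s • h i := by
        ext x
        simp [hf, Finset.sum_apply]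
      simp only [hs]
      exact Submodule.sum_mem _ fun i _ =>
        Submodule.smul_mem _ _ (Submodule.subset_span ⟨i, rfl⟩)
    have : FiniteDimensional k (Submodule.span k (Set.range h)) :=
      FiniteDimensional.span_of_finite k (Set.finite_range h)
    exact Submodule.finiteDimensional_of_le hle
end

section
/- Let k be a field, (S,·) a semigroup and f : S → k a function. Then there exist n ∈ ℕ and functions g₁,…,gₙ, h₁,…,hₙ : S → k with f(x·y) = Σ_{i=1}^n gᵢ(x)·hᵢ(y) for all x, y ∈ S, if and only if there exist n ∈ ℕ, a row vector λ : Fin n → k, a column vector γ : Fin n → k and a semigroup (multiplicative) homomorphism μ : S → Matrix (Fin n) (Fin n) k such that f(s) = Σ_{i,j} λᵢ · (μ(s))ᵢⱼ · γⱼ for all s ∈ S. -/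
/-- Right translation of functions on a monoid, as a representation of the monoid. -/
def rightTranslation (k M : Type*) [CommSemiring k] [Monoid M] :
    M →* Module.End k (M → k) where
  toFun t := LinearMap.funLeft k k (· * t)
  map_one' := by ext; simp [LinearMap.funLeft]
  map_mul' s t := by
    refine LinearMap.ext fun F => funext fun x => ?_
    simp [LinearMap.funLeft, mul_assoc]

@[simp]
theorem rightTranslation_apply {k M : Type*} [CommSemiring k] [Monoid M] (t : M) (F : M → k)
    (x : M) : rightTranslation k M t F x = F (x * t) := rfl

/-- A function on a monoid whose right translates span a finite-dimensional space is a matrix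
coefficient of a finite-dimensional representation. -/
theorem exists_matrix_representation_of_finiteDimensional {k M : Type*} [Field k] [Monoid M]
    (F : M → k)
    (hF : FiniteDimensional k
      (Submodule.span k (Set.range fun t => rightTranslation k M t F))) :
    ∃ (n : ℕ) (lam gam : Fin n → k) (μ : M →* Matrix (Fin n) (Fin n) k),
      ∀ s : M, F s = ∑ i, ∑ j, lam i * μ s i j * gam j := by
  set W := Submodule.span k (Set.range fun t => rightTranslation k M t F) with hW
  have hinv (s : M) : ∀ w ∈ W, rightTranslation k M s w ∈ W := by
    intro w hw
    have hle : W ≤ W.comap (rightTranslation k M s) := by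
      rw [hW, Submodule.span_le]
      rintro _ ⟨t, rfl⟩
      refine Submodule.subset_span ⟨s * t, ?_⟩
      simp
    exact hle hw
  have hFW : F ∈ W := Submodule.subset_span ⟨1, by simp⟩
  let b := Module.finBasis k W
  let μ : M →* Matrix (Fin (Module.finrank k W)) (Fin (Module.finrank k W)) k :=
    { toFun := fun s => LinearMap.toMatrix b b ((rightTranslation k M s).restrict (hinv s))
      map_one' := by
        rw [← LinearMap.toMatrix_one b]
        congr 1
        ext
        simp
      map_mul' := fun s t => by
        rw [← LinearMap.toMatrix_mul]
        congr 1
        ext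
        simp }
  refine ⟨_, fun i => (b i : M → k) 1, b.repr ⟨F, hFW⟩, μ, fun s => ?_⟩
  have hrepr (i) : ∑ j, μ s i j * b.repr ⟨F, hFW⟩ j =
      b.repr ((rightTranslation k M s).restrict (hinv s) ⟨F, hFW⟩) i :=
    congrFun (LinearMap.toMatrix_mulVec_repr b b _ _) i
  simp only [mul_assoc, ← Finset.mul_sum, hrepr]
  have hsum := congrArg (fun w : W => (w : M → k) 1)
    (b.sum_repr ((rightTranslation k M s).restrict (hinv s) ⟨F, hFW⟩))
  simp only [Submodule.coe_sum, Finset.sum_apply, Submodule.coe_smul, Pi.smul_apply, smul_eq_mul,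
    LinearMap.coe_restrict_apply, rightTranslation_apply, one_mul] at hsum
  rw [← hsum]
  exact Finset.sum_congr rfl fun i _ => mul_comm _ _

/-- Extension of a function on a semigroup to the semigroup with a unit adjoined. -/
def extendWithOne {k S : Type*} (a : k) (f : S → k) : WithOne S → k :=
  WithOne.recOneCoe a f

/-- If `f (x * y)` decomposes finitely, the right translates of the extension of `f` by zero to
`WithOne S` span a finite-dimensional space. -/
theorem finiteDimensional_span_rightTranslation {k S : Type*} [Field k] [Semigroup S] (f : S → k)
    {n : ℕ} (g h : Fin n → S → k) (hf : ∀ x y : S, f (x * y) = ∑ i, g i x * h i y) :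
    FiniteDimensional k (Submodule.span k
      (Set.range fun t => rightTranslation k (WithOne S) t (extendWithOne 0 f))) := by
  let A : Set (WithOne S → k) := insert (extendWithOne 0 f)
    (insert (extendWithOne 1 0) (Set.range fun i => extendWithOne 0 (g i)))
  have hA : A.Finite := ((Set.finite_range _).insert _).insert _
  have := FiniteDimensional.span_of_finite k hA
  refine Submodule.finiteDimensional_of_le (S₂ := Submodule.span k A) (Submodule.span_le.2 ?_)
  rintro _ ⟨t, rfl⟩
  induction t using WithOne.recOneCoe with
  | one => exact Submodule.subset_span (Or.inl (by simp))
  | coe t =>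
    have ht : rightTranslation k (WithOne S) t (extendWithOne 0 f) =
        f t • extendWithOne 1 0 + ∑ i, h i t • extendWithOne 0 (g i) := by
      funext x
      induction x using WithOne.recOneCoe with
      | one => simp [extendWithOne]
      | coe x =>
        simp [extendWithOne, ← WithOne.coe_mul, hf, mul_comm]
    simp only [ht]
    exact add_mem (Submodule.smul_mem _ _ (Submodule.subset_span (by simp [A])))
      (Submodule.sum_mem _ fun i _ => Submodule.smul_mem _ _ (Submodule.subset_span (by simp [A])))

/-- Let `k` be a field, `(S, ·)` a semigroup and `f : S → k`.  There is a
finite decomposition `f (x * y) = ∑ i, gᵢ x * hᵢ y` iff there exist `n`, a row `λ`, a column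
`γ` and a semigroup (multiplicative) homomorphism `μ : S → k^{n×n}` with
`f s = ∑ i j, λ i * (μ s) i j * γ j`. -/
theorem finite_decomposition_iff_matrix_representation
    {k S : Type*} [Field k] [Semigroup S] (f : S → k) :
    (∃ (n : ℕ) (g h : Fin n → S → k), ∀ x y : S, f (x * y) = ∑ i, g i x * h i y) ↔
    (∃ (n : ℕ) (lam gam : Fin n → k) (μ : S →ₙ* Matrix (Fin n) (Fin n) k),
      ∀ s : S, f s = ∑ i, ∑ j, lam i * μ s i j * gam j) := by
  constructor
  · rintro ⟨n, g, h, hf⟩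
    obtain ⟨m, lam, gam, μ, hμ⟩ := exists_matrix_representation_of_finiteDimensional _
      (finiteDimensional_span_rightTranslation f g h hf)
    exact ⟨m, lam, gam, (μ : WithOne S →ₙ* Matrix (Fin m) (Fin m) k).comp WithOne.coeMulHom,
      fun s => hμ s⟩
  · rintro ⟨n, lam, gam, μ, hf⟩
    refine ⟨n, fun l x => ∑ i, lam i * μ x i l, fun l y => ∑ j, μ y l j * gam j, fun x y => ?_⟩
    simp only [hf, map_mul, Matrix.mul_apply, Finset.mul_sum, Finset.sum_mul]
    rw [Finset.sum_comm, Finset.sum_comm_cycle]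
    simp only [mul_assoc]
end

section
/- Let k be a field, (M,·,1) a monoid and f : M → k a function whose family of right shifts (f_s)_{s∈M} has finite rank in k^M. Then there exist n ∈ ℕ, a row vector λ : Fin n → k, a column vector γ : Fin n → k and a monoid homomorphism μ : M → Matrix (Fin n) (Fin n) k (in particular μ(1) is the identity matrix) such that f(s) = Σ_{i,j} λᵢ · (μ(s))ᵢⱼ · γⱼ for all s ∈ M. -/
/-- The span of the right shifts of a function on a monoid is stable under right shifts. -/
theorem funLeft_mul_mem_span_shifts {k M : Type*} [Field k] [Monoid M] (f : M → k) (s : M) :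
    ∀ g ∈ Submodule.span k (Set.range fun t : M => fun x : M => f (t * x)),
      LinearMap.funLeft k k (s * ·) g ∈
        Submodule.span k (Set.range fun t : M => fun x : M => f (t * x)) := by
  intro g hg
  induction hg using Submodule.span_induction with
  | mem g hg =>
    obtain ⟨t, rfl⟩ := hg
    refine Submodule.subset_span ⟨t * s, ?_⟩
    funext x
    simp [LinearMap.funLeft_apply, mul_assoc]
  | zero => simp
  | add g h _ _ hg hh => simpa using Submodule.add_mem _ hg hh
  | smul c g _ hg => simpa using Submodule.smul_mem _ c hg

/-- Let `k` be a field, `M` a monoid and `f : M → k` a function whose family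
of right shifts `(f_s)_{s ∈ M}` has finite rank in `k^M`.  Then there exist `n`, a row `λ`,
a column `γ` and a **monoid** homomorphism `μ : M →* k^{n×n}` (so `μ 1` is the identity
matrix) with `f s = ∑ i j, λ i * (μ s) i j * γ j` for all `s`. -/
theorem representative_function_monoid_matrix_representation
    {k M : Type*} [Field k] [Monoid M] (f : M → k)
    (hf : FiniteDimensional k
      ↥(Submodule.span k (Set.range fun s : M => fun x : M => f (s * x)))) :
    ∃ (n : ℕ) (lam gam : Fin n → k) (μ : M →* Matrix (Fin n) (Fin n) k),
      ∀ s : M, f s = ∑ i, ∑ j, lam i * μ s i j * gam j := by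
  set V := Submodule.span k (Set.range fun s : M => fun x : M => f (s * x))
  let R (s : M) : V →ₗ[k] V :=
    (LinearMap.funLeft k k (s * ·)).restrict (funLeft_mul_mem_span_shifts f s)
  have hR (s : M) (g : V) (x : M) : (R s g : M → k) x = (g : M → k) (s * x) := rfl
  let b := Module.finBasis k V
  have hfV : f ∈ V := Submodule.subset_span ⟨1, by simp⟩
  refine ⟨Module.finrank k V, fun i => b.repr ⟨f, hfV⟩ i, fun j => (b j : M → k) 1,
    { toFun := fun s => (LinearMap.toMatrix b b (R s)).transpose
      map_one' := ?_
      map_mul' := fun s t => ?_ }, fun s => ?_⟩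
  · have h : R 1 = LinearMap.id := by
      ext g x
      simp [hR]
    rw [h, LinearMap.toMatrix_id, Matrix.transpose_one]
  · have h : R (s * t) = R t ∘ₗ R s := by
      ext g x
      simp [hR, mul_assoc]
    rw [h, LinearMap.toMatrix_comp b b b, Matrix.transpose_mul]
  · have eval_eq (g : V) : (g : M → k) 1 = ∑ j, b.repr g j * (b j : M → k) 1 := by
      conv_lhs => rw [← b.sum_repr g]
      simp [-Module.Basis.sum_repr]
    calc f s = (R s ⟨f, hfV⟩ : M → k) 1 := by rw [hR, mul_one]
      _ = (R s (∑ i, b.repr ⟨f, hfV⟩ i • b i) : M → k) 1 := by rw [b.sum_repr]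
      _ = ∑ i, b.repr ⟨f, hfV⟩ i * (R s (b i) : M → k) 1 := by
        simp [-Module.Basis.sum_repr]
      _ = _ := by
        refine Finset.sum_congr rfl fun i _ => ?_
        rw [eval_eq, Finset.mul_sum]
        refine Finset.sum_congr rfl fun j _ => ?_
        simp [LinearMap.toMatrix_apply, mul_assoc]
end

section
/- Let k be a field and G a group. Every function f : G → k is representative (i.e. R(k,G,·) = k^G) if and only if G is finite. -/
/-- Let `k` be a field and `G` a group.  Every function `f : G → k` is
representative (the span of its right shifts is finite-dimensional) iff `G` is finite,
i.e. `R(k, G, ·) = k^G ↔ G` finite. -/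
theorem all_functions_representative_iff_finite_group
    {k G : Type*} [Field k] [Group G] :
    (∀ f : G → k,
      FiniteDimensional k
        ↥(Submodule.span k (Set.range fun s : G => fun x : G => f (s * x)))) ↔
    Finite G := by
  classical
  refine ⟨fun h => ?_, fun _ f => FiniteDimensional.span_of_finite k (Set.finite_range _)⟩
  -- The shifts of the indicator function of `1` are the indicator functions of all points.
  have := h (Pi.single 1 1)
  have hli : LinearIndependent k
      fun s : G => fun x : G => (Pi.single 1 1 : G → k) (s * x) := by
    rw [linearIndependent_iff']
    intro t g hg i hi
    simpa [Finset.sum_apply, Pi.single_apply, mul_inv_eq_one, hi] using congrFun hg i⁻¹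
  exact (linearIndependent_span hli).finite
end

section
/- Let G be a finite group and k a field, and endow S = ℕ × G with the binary operation (n,g) * (m,h) = (0, g·h). Then * is associative (so (S,*) is a semigroup), and every function f : S → k admits a finite decomposition: there exist n ∈ ℕ and functions g₁,…,gₙ, h₁,…,hₙ : S → k such that f(x * y) = Σ_{i=1}^n gᵢ(x)·hᵢ(y) for all x, y ∈ S; in particular R(k,S,*) = k^S even though S is infinite. -/
/-- Let `G` be a finite group, `k` a field, and endow `S = ℕ × G` with the
law `(n, g) * (m, h) = (0, g * h)`.  Then this law is associative (so `S` is a semigroup),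
and every `f : S → k` admits a finite decomposition `f (x * y) = ∑ i, gᵢ x * hᵢ y`;
hence `R(k, S, *) = k^S` even though `S` is infinite. -/
theorem counterexample_semigroup_all_functions_representative
    {k G : Type*} [Field k] [Group G] [Finite G]
    (mul : (ℕ × G) → (ℕ × G) → (ℕ × G))
    (hmul : ∀ p q : ℕ × G, mul p q = (0, p.2 * q.2)) :
    (∀ p q r : ℕ × G, mul (mul p q) r = mul p (mul q r)) ∧
    ∀ f : ℕ × G → k, ∃ (n : ℕ) (g h : Fin n → ℕ × G → k),
      ∀ x y : ℕ × G, f (mul x y) = ∑ i, g i x * h i y := by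
  refine ⟨fun p q r => by simp [hmul, mul_assoc], fun f => ?_⟩
  obtain ⟨n, ⟨e⟩⟩ := Finite.exists_equiv_fin G
  refine ⟨n, fun i x => if e x.2 = i then 1 else 0, fun i y => f (0, e.symm i * y.2),
    fun x y => ?_⟩
  simp [hmul]
end

section
/- Let k be a semiring, X a set, M = X* the free monoid on X, and f : M → k a function. Then the following are equivalent: (i) there exists a finitely generated left k-submodule N of the left k-module of all functions M → k such that f ∈ N and N is stable under every right-shift operator g ↦ g_a (where g_a(x) = g(a·x)) for a ∈ M; (iii) there exist n ∈ ℕ, λ : Fin n → k, γ : Fin n → k and a monoid homomorphism μ : M → Matrix (Fin n) (Fin n) k such that f(w) = Σ_{i,j} λᵢ · (μ(w))ᵢⱼ · γⱼ for all w ∈ M. -/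
open Matrix in
/-- If each letter `x` shifts the family `g` by the matrix `m x`, then each word `a` shifts it by
the product of the matrices of its letters. -/
theorem FreeMonoid.shift_eq_lift_mulVec {k X ι : Type*} [Semiring k] [Fintype ι] [DecidableEq ι]
    {g : ι → FreeMonoid X → k} {m : X → Matrix ι ι k}
    (h : ∀ x y i, g i (FreeMonoid.of x * y) = (m x *ᵥ fun j => g j y) i)
    (a y : FreeMonoid X) :
    (fun i => g i (a * y)) = FreeMonoid.lift m a *ᵥ fun j => g j y := by
  induction a using FreeMonoid.inductionOn' with
  | one => simp
  | of_mul x a ih =>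
    funext i
    rw [mul_assoc, h, ih, map_mul, FreeMonoid.lift_eval_of, Matrix.mulVec_mulVec]

/-- The right-shift operator `g ↦ (x ↦ g (a * x))` as a linear endomorphism of `M → k` maps the
span of a family `g` into itself as soon as it maps each member of the family into the span. -/
theorem Submodule.shift_mem_span_range {k M ι : Type*} [Semiring k] [Mul M] {g : ι → M → k}
    {a : M} (h : ∀ i, (fun x => g i (a * x)) ∈ Submodule.span k (Set.range g))
    {p : M → k} (hp : p ∈ Submodule.span k (Set.range g)) :
    (fun x => p (a * x)) ∈ Submodule.span k (Set.range g) := by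
  have hle : Submodule.span k (Set.range g) ≤
      (Submodule.span k (Set.range g)).comap (LinearMap.funLeft k k (a * ·)) := by
    rw [Submodule.span_le]
    rintro _ ⟨i, rfl⟩
    exact h i
  exact hle hp


/-- **Kleene–Schützenberger.** Let `k` be a semiring, `M = X*` the free monoid
on `X` and `f : M → k`.  Then `f` belongs to a finitely generated left `k`-submodule of
`k^M` stable under all right-shift operators `g ↦ (x ↦ g (a * x))` iff there exist `n`,
`λ γ : Fin n → k` and a monoid homomorphism `μ : M →* k^{n×n}` with
`f w = ∑ i j, λ i * (μ w) i j * γ j` for all `w`. -/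
theorem kleene_schutzenberger_stable_submodule_iff_matrix_representation
    {k X : Type*} [Semiring k] (f : FreeMonoid X → k) :
    (∃ N : Submodule k (FreeMonoid X → k), N.FG ∧ f ∈ N ∧
        ∀ a : FreeMonoid X, ∀ g ∈ N, (fun x => g (a * x)) ∈ N) ↔
    (∃ (n : ℕ) (lam gam : Fin n → k) (μ : FreeMonoid X →* Matrix (Fin n) (Fin n) k),
        ∀ w : FreeMonoid X, f w = ∑ i, ∑ j, lam i * μ w i j * gam j) := by
  constructor
  · rintro ⟨N, hN, hf, hstable⟩
    obtain ⟨n, g, rfl⟩ := Submodule.fg_iff_exists_fin_generating_family.mp hN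
    obtain ⟨lam, rfl⟩ := (Submodule.mem_span_range_iff_exists_fun k).mp hf
    have hshift (x : X) (i : Fin n) :
        ∃ c : Fin n → k, ∑ j, c j • g j = fun y => g i (FreeMonoid.of x * y) :=
      (Submodule.mem_span_range_iff_exists_fun k).mp
        (hstable _ _ (Submodule.subset_span ⟨i, rfl⟩))
    choose m hm using hshift
    refine ⟨n, lam, fun j => g j 1, FreeMonoid.lift fun x => Matrix.of (m x), fun w => ?_⟩
    have key := FreeMonoid.shift_eq_lift_mulVec (g := g) (m := fun x => Matrix.of (m x))
      (fun x y i => by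
        rw [← congrFun (hm x i) y]
        simp [Matrix.mulVec, dotProduct]) w 1
    have hg (i : Fin n) := congrFun key i
    simp only [mul_one, Matrix.mulVec, dotProduct] at hg
    simp [Finset.sum_apply, hg, Finset.mul_sum, mul_assoc]
  · rintro ⟨n, lam, gam, μ, hf⟩
    let g : Fin n → FreeMonoid X → k := fun i w => ∑ j, μ w i j * gam j
    refine ⟨Submodule.span k (Set.range g), Submodule.fg_span (Set.finite_range g),
      (Submodule.mem_span_range_iff_exists_fun k).mpr ⟨lam, ?_⟩,
      fun a p hp => Submodule.shift_mem_span_range (fun i => ?_) hp⟩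
    · funext w
      simp [g, hf, Finset.sum_apply, Finset.mul_sum, mul_assoc]
    · refine (Submodule.mem_span_range_iff_exists_fun k).mpr ⟨μ a i, ?_⟩
      funext w
      have := congrFun (Matrix.mulVec_mulVec gam (μ a) (μ w)) i
      simpa [g, Finset.sum_apply, Matrix.mulVec, dotProduct] using this
end

section
/- Let k be a semiring, X a set, M = X* the free monoid on X, and f : M → k a function. Then the family of right shifts (f_w)_{w∈M} is contained in a finitely generated shift-invariant left k-submodule of k^M (i.e. there is a finitely generated left k-submodule N with f ∈ N stable under all operators g ↦ g_a, g_a(x) = g(a·x)) if and only if the family of left shifts (ᵥf)_{v∈M} is contained in a finitely generated shift-invariant right k-submodule of k^M (i.e. there is a finitely generated right k-submodule N' with f ∈ N' stable under all operators g ↦ ₐg, ₐg(x) = g(x·a)). -/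
open Matrix MulOpposite

/-- A function on the free monoid is recognizable if it is given by a linear representation
`w ↦ l * μ w * r` with `μ` a matrix representation of the free monoid. -/
def IsRecognizable {k X : Type*} [Semiring k] (f : FreeMonoid X → k) : Prop :=
  ∃ (n : ℕ) (l : Fin n → k) (μ : FreeMonoid X →* Matrix (Fin n) (Fin n) k) (r : Fin n → k),
    ∀ w, f w = l ⬝ᵥ (μ w *ᵥ r)

theorem isRecognizable_iff_exists_left_submodule {k X : Type*} [Semiring k]
    (f : FreeMonoid X → k) :
    IsRecognizable f ↔ ∃ N : Submodule k (FreeMonoid X → k), N.FG ∧ f ∈ N ∧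
      ∀ a : FreeMonoid X, ∀ g ∈ N, (fun x => g (a * x)) ∈ N := by
  constructor
  · rintro ⟨n, l, μ, r, hf⟩
    let v : Fin n → FreeMonoid X → k := fun i w => (μ w *ᵥ r) i
    refine ⟨Submodule.span k (Set.range v), Submodule.fg_span (Set.finite_range v), ?_, ?_⟩
    · refine Submodule.mem_span_range_iff_exists_fun k |>.2 ⟨l, ?_⟩
      ext w
      simp [hf, v, dotProduct]
    · intro a g hg
      obtain ⟨c, rfl⟩ := Submodule.mem_span_range_iff_exists_fun k |>.1 hg
      refine Submodule.mem_span_range_iff_exists_fun k |>.2 ⟨c ᵥ* μ a, ?_⟩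
      ext w
      have h := dotProduct_mulVec c (μ a) (μ w *ᵥ r)
      rw [mulVec_mulVec, ← map_mul] at h
      simpa [v, dotProduct] using h.symm
  · rintro ⟨N, hN, hf, hshift⟩
    obtain ⟨n, v, rfl⟩ := Submodule.fg_iff_exists_fin_generating_family.1 hN
    obtain ⟨l, rfl⟩ := Submodule.mem_span_range_iff_exists_fun k |>.1 hf
    have hA (x : X) (i : Fin n) :=
      Submodule.mem_span_range_iff_exists_fun k |>.1
        (hshift (FreeMonoid.of x) (v i) (Submodule.subset_span ⟨i, rfl⟩))
    choose A hA using hA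
    let μ : FreeMonoid X →* Matrix (Fin n) (Fin n) k := FreeMonoid.lift fun x => of (A x)
    have hv (w : FreeMonoid X) : (fun i => v i w) = μ w *ᵥ fun i => v i 1 := by
      induction w using FreeMonoid.inductionOn' with
      | one => simp
      | of_mul x w ih =>
        rw [map_mul, ← mulVec_mulVec, ← ih]
        ext i
        simpa [μ, mulVec, dotProduct] using (congrFun (hA x i) w).symm
    refine ⟨n, l, μ, fun i => v i 1, fun w => ?_⟩
    rw [← hv]
    simp [dotProduct]

theorem isRecognizable_iff_exists_right_submodule {k X : Type*} [Semiring k]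
    (f : FreeMonoid X → k) :
    IsRecognizable f ↔ ∃ N : Submodule kᵐᵒᵖ (FreeMonoid X → k), N.FG ∧ f ∈ N ∧
      ∀ a : FreeMonoid X, ∀ g ∈ N, (fun x => g (x * a)) ∈ N := by
  constructor
  · rintro ⟨n, l, μ, r, hf⟩
    let v : Fin n → FreeMonoid X → k := fun i w => (l ᵥ* μ w) i
    refine ⟨Submodule.span kᵐᵒᵖ (Set.range v), Submodule.fg_span (Set.finite_range v), ?_, ?_⟩
    · refine Submodule.mem_span_range_iff_exists_fun kᵐᵒᵖ |>.2 ⟨fun i => op (r i), ?_⟩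
      ext w
      rw [hf, dotProduct_mulVec]
      simp [v, dotProduct]
    · intro a g hg
      obtain ⟨c, rfl⟩ := Submodule.mem_span_range_iff_exists_fun kᵐᵒᵖ |>.1 hg
      refine Submodule.mem_span_range_iff_exists_fun kᵐᵒᵖ |>.2
        ⟨fun i => op ((μ a *ᵥ fun j => unop (c j)) i), ?_⟩
      ext w
      have h := dotProduct_mulVec (l ᵥ* μ w) (μ a) (fun j => unop (c j))
      rw [vecMul_vecMul, ← map_mul] at h
      simpa [v, dotProduct, smul_eq_mul_unop] using h
  · rintro ⟨N, hN, hf, hshift⟩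
    obtain ⟨n, v, rfl⟩ := Submodule.fg_iff_exists_fin_generating_family.1 hN
    obtain ⟨r, rfl⟩ := Submodule.mem_span_range_iff_exists_fun kᵐᵒᵖ |>.1 hf
    have hA (x : X) (j : Fin n) :=
      Submodule.mem_span_range_iff_exists_fun kᵐᵒᵖ |>.1
        (hshift (FreeMonoid.of x) (v j) (Submodule.subset_span ⟨j, rfl⟩))
    choose A hA using hA
    let μ : FreeMonoid X →* Matrix (Fin n) (Fin n) k :=
      FreeMonoid.lift fun x => of fun i j => unop (A x j i)
    have hstep (w : FreeMonoid X) (x : X) :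
        (fun j => v j (w * FreeMonoid.of x)) = (fun j => v j w) ᵥ* μ (FreeMonoid.of x) := by
      ext j
      simpa [μ, vecMul, dotProduct, smul_eq_mul_unop] using (congrFun (hA x j) w).symm
    have hv (w u : FreeMonoid X) : (fun j => v j (u * w)) = (fun j => v j u) ᵥ* μ w := by
      induction w using FreeMonoid.inductionOn' generalizing u with
      | one => simp
      | of_mul x w ih => rw [map_mul, ← vecMul_vecMul, ← hstep, ← ih, mul_assoc]
    refine ⟨n, fun j => v j 1, μ, fun j => unop (r j), fun w => ?_⟩
    rw [dotProduct_mulVec, ← hv, one_mul]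
    simp [dotProduct, smul_eq_mul_unop]

/-- Let `k` be a semiring, `M = X*` the free monoid on `X` and `f : M → k`.
The family of right shifts of `f` is contained in a finitely generated shift-invariant left
`k`-submodule of `k^M` iff the family of left shifts of `f` is contained in a finitely
generated shift-invariant right `k`-submodule of `k^M` (right modules being modules over
the opposite semiring `kᵐᵒᵖ`). -/
theorem right_shift_left_submodule_iff_left_shift_right_submodule
    {k X : Type*} [Semiring k] (f : FreeMonoid X → k) :
    (∃ N : Submodule k (FreeMonoid X → k), N.FG ∧ f ∈ N ∧
        ∀ a : FreeMonoid X, ∀ g ∈ N, (fun x => g (a * x)) ∈ N) ↔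
    (∃ N : Submodule kᵐᵒᵖ (FreeMonoid X → k), N.FG ∧ f ∈ N ∧
        ∀ a : FreeMonoid X, ∀ g ∈ N, (fun x => g (x * a)) ∈ N) := by
  rw [← isRecognizable_iff_exists_left_submodule, isRecognizable_iff_exists_right_submodule]
end

section
/- Let f : ℕ → ℕ be defined by f(n) = n + 1 (the coefficient function of the series (a*)² over the semiring ℕ), and for k ∈ ℕ let f_k : ℕ → ℕ be the shift f_k(n) = f(k + n). Then (a) f_k(n) = k + f(n) for all k, n ∈ ℕ, and (b) for every k ∈ ℕ there exist no coefficients c₀, …, c_k ∈ ℕ such that f_{k+1}(n) = Σ_{s=0}^{k} c_s · f_s(n) for all n ∈ ℕ; i.e. f has infinitely many shifts, none of which lies in the ℕ-span of the preceding ones. -/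
/-- Let `f : ℕ → ℕ`, `f n = n + 1` (the coefficient function of the series
`(a*)²` over the semiring `ℕ`), and for `k ∈ ℕ` let `f_k : n ↦ f (k + n)` be its shifts.
Then (a) `f_k n = k + f n`, and (b) for every `k` there are no coefficients
`c₀, …, c_k ∈ ℕ` with `f_{k+1} = ∑_{s=0}^{k} c_s • f_s`: the shifts of `f` are infinitely
many and none lies in the `ℕ`-span of the preceding ones. -/
theorem shifts_of_a_star_squared_not_finitely_generated
    (f : ℕ → ℕ) (hf : ∀ n : ℕ, f n = n + 1) :
    (∀ k n : ℕ, f (k + n) = k + f n) ∧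
    ∀ k : ℕ, ¬ ∃ c : Fin (k + 1) → ℕ,
      ∀ n : ℕ, f ((k + 1) + n) = ∑ s : Fin (k + 1), c s * f ((s : ℕ) + n) := by
  refine ⟨fun k n => by rw [hf, hf, add_assoc], ?_⟩
  rintro k ⟨c, hc⟩
  have h₀ := hc 0
  have h₁ := hc 1
  simp only [hf, add_zero] at h₀ h₁
  have hsplit : ∑ s : Fin (k + 1), c s * ((s : ℕ) + 1 + 1) =
      ∑ s : Fin (k + 1), c s * ((s : ℕ) + 1) + ∑ s : Fin (k + 1), c s := by
    rw [← Finset.sum_add_distrib]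
    exact Finset.sum_congr rfl fun s _ => by ring
  have hsum : ∑ s : Fin (k + 1), c s = 1 := by omega
  have hle : ∑ s : Fin (k + 1), c s * ((s : ℕ) + 1) ≤ (∑ s : Fin (k + 1), c s) * (k + 1) := by
    rw [Finset.sum_mul]
    exact Finset.sum_le_sum fun s _ => Nat.mul_le_mul_left _ s.isLt
  rw [hsum] at hle
  omega
end

section
/- Let k be a field, A a (unital associative) k-algebra, and Δ : A → A ⊗[k] A a homomorphism of k-algebras. If f, g : A → k are representative linear forms, then the linear form h : A → k defined by h = (f ⊗ g) ∘ Δ (i.e. h(a) is the image of Δ(a) under the linear map A ⊗ A → k induced by (x,y) ↦ f(x)·g(y)) is also a representative linear form. In other words, Sweedler's dual A° is closed under the dual law ᵗΔ. -/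
open TensorProduct

/-- A linear form `f` on a `k`-algebra `A` is *representative* if the span of its right
shifts `x ↦ f (b * x)`, `b ∈ A`, is finite-dimensional in the dual of `A`. -/
def IsRepresentativeForm {k A : Type*} [Field k] [Ring A] [Algebra k A]
    (f : A →ₗ[k] k) : Prop :=
  FiniteDimensional k
    ↥(Submodule.span k (Set.range fun b : A => f ∘ₗ LinearMap.mulLeft k b))

/-- Right shifts of `f ⊗ g` on `A ⊗[k] B` lie in the span of the products of a right shift of `f`
and a right shift of `g`. -/
theorem dualDistrib_comp_mulLeft_mem {k A B : Type*} [Field k] [Ring A] [Algebra k A]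
    [Ring B] [Algebra k B] (f : A →ₗ[k] k) (g : B →ₗ[k] k) (t : A ⊗[k] B) :
    dualDistrib k A B (f ⊗ₜ g) ∘ₗ LinearMap.mulLeft k t ∈
      Submodule.map₂ ((TensorProduct.mk k _ _).compr₂ (dualDistrib k A B))
        (Submodule.span k (Set.range fun a : A => f ∘ₗ LinearMap.mulLeft k a))
        (Submodule.span k (Set.range fun b : B => g ∘ₗ LinearMap.mulLeft k b)) := by
  induction t with
  | zero =>
    rw [LinearMap.mulLeft_zero_eq_zero, LinearMap.comp_zero]
    exact zero_mem _
  | tmul a b =>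
    convert Submodule.apply_mem_map₂ ((TensorProduct.mk k _ _).compr₂ (dualDistrib k A B))
      (Submodule.subset_span (Set.mem_range_self a)) (Submodule.subset_span (Set.mem_range_self b))
      using 1
    ext x y
    simp
  | add s t hs ht =>
    convert add_mem hs ht using 1
    ext x y
    simp [add_mul]

/-- Let `k` be a field, `A` a unital associative `k`-algebra and
`Δ : A → A ⊗[k] A` a homomorphism of `k`-algebras.  If `f, g : A → k` are representative
linear forms then so is `h = (f ⊗ g) ∘ Δ`: Sweedler's dual `A°` is closed under the
dual law `ᵗΔ`. -/
theorem sweedler_dual_closed_under_dual_law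
    {k A : Type*} [Field k] [Ring A] [Algebra k A]
    (Δ : A →ₐ[k] A ⊗[k] A) (f g : A →ₗ[k] k)
    (hf : IsRepresentativeForm f) (hg : IsRepresentativeForm g) :
    IsRepresentativeForm
      ((TensorProduct.lift ((LinearMap.mul k k).compl₁₂ f g)) ∘ₗ Δ.toLinearMap) := by
  have hfg := (Module.Finite.iff_fg.mp hf).map₂
    ((TensorProduct.mk k _ _).compr₂ (dualDistrib k A A)) (Module.Finite.iff_fg.mp hg)
  have := Module.Finite.iff_fg.mpr (hfg.map Δ.toLinearMap.dualMap)
  refine @Submodule.finiteDimensional_of_le _ _ _ _ _ _ _ this (Submodule.span_le.mpr ?_)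
  rintro _ ⟨b, rfl⟩
  refine ⟨_, dualDistrib_comp_mulLeft_mem f g (Δ b), ?_⟩
  have hlift : TensorProduct.lift ((LinearMap.mul k k).compl₁₂ f g) =
      dualDistrib k A A (f ⊗ₜ g) := by
    ext x y
    simp
  ext x
  simp [hlift]
end

section
/- Let f : ℚ[X] → ℚ be the linear form with f(Xⁿ) = 1 for all n ≥ 0, and let Δ : ℚ[X] → ℚ[X] ⊗ ℚ[X] be the linear map (not an algebra morphism) with Δ(Xⁿ) = (1/n!)·(Xⁿ ⊗ Xⁿ) for all n ≥ 0. Then f is a representative linear form, but the linear form h = (f ⊗ f) ∘ Δ, which satisfies h(Xⁿ) = 1/n! for all n, is not representative: the set of right shifts {p ↦ h(q·p) : q ∈ ℚ[X]} spans an infinite-dimensional subspace of the dual of ℚ[X]. -/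
open TensorProduct Polynomial

/-- A linear form `f` on `ℚ[X]` is *representative* if the span of its right shifts
`p ↦ f (q * p)`, `q ∈ ℚ[X]`, is finite-dimensional in the dual of `ℚ[X]`. -/
def IsRepresentativeFormQX (f : Polynomial ℚ →ₗ[ℚ] ℚ) : Prop :=
  FiniteDimensional ℚ
    ↥(Submodule.span ℚ (Set.range fun q : Polynomial ℚ => f ∘ₗ LinearMap.mulLeft ℚ q))

/-- The linear form with all moments equal to `1` is evaluation at `1`. -/
theorem apply_eq_eval_one_of_apply_X_pow {f : Polynomial ℚ →ₗ[ℚ] ℚ}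
    (hf : ∀ n : ℕ, f (X ^ n) = 1) (p : Polynomial ℚ) : f p = p.eval 1 := by
  have h : f = Polynomial.leval 1 := by
    refine Polynomial.lhom_ext' fun n => LinearMap.ext_ring ?_
    simp [← X_pow_eq_monomial, hf]
  simp [h]

theorem isRepresentativeFormQX_of_map_mul {f : Polynomial ℚ →ₗ[ℚ] ℚ}
    (hf : ∀ p q, f (p * q) = f p * f q) : IsRepresentativeFormQX f := by
  refine Submodule.finiteDimensional_of_le (S₂ := Submodule.span ℚ {f}) (Submodule.span_le.2 ?_)
  rintro _ ⟨q, rfl⟩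
  exact Submodule.mem_span_singleton.2 ⟨f q, LinearMap.ext fun p => by simp [hf]⟩

/-- A representative linear form vanishes on a nonzero principal ideal. -/
theorem IsRepresentativeFormQX.exists_ne_zero {h : Polynomial ℚ →ₗ[ℚ] ℚ}
    (hh : IsRepresentativeFormQX h) : ∃ q : Polynomial ℚ, q ≠ 0 ∧ ∀ p, h (q * p) = 0 := by
  by_contra! hne
  let S : Polynomial ℚ →ₗ[ℚ] Polynomial ℚ →ₗ[ℚ] ℚ := (LinearMap.mul ℚ (Polynomial ℚ)).compr₂ h
  have hS : Function.Injective S := by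
    rw [injective_iff_map_eq_zero]
    intro q hq
    by_contra hq0
    obtain ⟨p, hp⟩ := hne q hq0
    exact hp (LinearMap.congr_fun hq p)
  have hmem (q) : S q ∈ Submodule.span ℚ
      (Set.range fun q : Polynomial ℚ => h ∘ₗ LinearMap.mulLeft ℚ q) :=
    Submodule.subset_span ⟨q, rfl⟩
  unfold IsRepresentativeFormQX at hh
  exact Polynomial.not_finite (R := ℚ) (Module.Finite.of_injective (S.codRestrict _ hmem)
    fun a b hab => hS (congrArg Subtype.val hab))

theorem factorial_add_mul_prod_Ico (n : ℕ) {k d : ℕ} (hkd : k ≤ d) :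
    (n + k).factorial * ∏ i ∈ Finset.Ico k d, (n + i + 1) = (n + d).factorial := by
  induction d, hkd using Nat.le_induction with
  | base => simp
  | succ d hkd ih =>
    rw [Finset.prod_Ico_succ_top hkd, ← mul_assoc, ih, ← add_assoc, Nat.factorial_succ, mul_comm]

/-- The sequence `1 / n!` satisfies no nontrivial linear recurrence with constant coefficients. -/
theorem eq_zero_of_sum_coeff_mul_inv_factorial {q : Polynomial ℚ}
    (hq : ∀ n : ℕ, ∑ k ∈ Finset.range (q.natDegree + 1),
      q.coeff k * ((n + k).factorial : ℚ)⁻¹ = 0) : q = 0 := by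
  set d := q.natDegree
  let P : Polynomial ℚ := ∑ k ∈ Finset.range (d + 1),
    C (q.coeff k) * ∏ i ∈ Finset.Ico k d, (X + C ((i : ℚ) + 1))
  have hP_nat (n : ℕ) : P.eval (n : ℚ) = 0 := by
    rw [← mul_zero ((n + d).factorial : ℚ), ← hq n, Finset.mul_sum]
    simp only [P, eval_finsetSum, eval_mul, eval_C, eval_prod, eval_add, eval_X]
    refine Finset.sum_congr rfl fun k hk => ?_
    rw [← factorial_add_mul_prod_Ico n (Nat.lt_succ_iff.1 (Finset.mem_range.1 hk))]
    have hfac : ((n + k).factorial : ℚ) ≠ 0 := by positivity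
    push_cast
    field_simp
    simp only [add_assoc]
  have hP : P = 0 := Polynomial.eq_zero_of_infinite_isRoot P
    ((Set.infinite_range_of_injective (Nat.cast_injective (R := ℚ))).mono
      (by rintro _ ⟨n, rfl⟩; exact hP_nat n))
  have hlead : P.eval (-(d : ℚ)) = q.coeff d := by
    simp only [P, eval_finsetSum, eval_mul, eval_C, eval_prod, eval_add, eval_X]
    rw [Finset.sum_range_succ, Finset.sum_eq_zero]
    · simp
    · intro k hk
      have hkd := Finset.mem_range.1 hk
      refine mul_eq_zero_of_right _ (Finset.prod_eq_zero (i := d - 1) (by simp; omega) ?_)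
      rw [Nat.cast_sub (by omega)]
      simp
  rw [hP, eval_zero] at hlead
  exact leadingCoeff_eq_zero.1 hlead.symm

theorem not_isRepresentativeFormQX_of_apply_X_pow {h : Polynomial ℚ →ₗ[ℚ] ℚ}
    (hh : ∀ n : ℕ, h (X ^ n) = (n.factorial : ℚ)⁻¹) : ¬ IsRepresentativeFormQX h := by
  intro hrep
  obtain ⟨q, hq0, hq⟩ := hrep.exists_ne_zero
  refine hq0 (eq_zero_of_sum_coeff_mul_inv_factorial fun n => ?_)
  rw [← hq (X ^ n)]
  conv_rhs => rw [q.as_sum_range_C_mul_X_pow, Finset.sum_mul, map_sum]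
  refine Finset.sum_congr rfl fun k _ => ?_
  rw [mul_assoc, ← pow_add, ← smul_eq_C_mul, map_smul, hh, add_comm, smul_eq_mul]

/-- **counterexample.** Let `f : ℚ[X] → ℚ` be the linear form with
`f (Xⁿ) = 1` and `Δ : ℚ[X] → ℚ[X] ⊗ ℚ[X]` the linear map (not an algebra morphism) with
`Δ (Xⁿ) = (1/n!) • (Xⁿ ⊗ Xⁿ)`.  Then `f` is representative, `h = (f ⊗ f) ∘ Δ` satisfies
`h (Xⁿ) = 1/n!`, yet `h` is **not** representative: its right shifts span an
infinite-dimensional subspace of the dual of `ℚ[X]`. -/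
theorem non_morphism_comultiplication_counterexample
    (f : Polynomial ℚ →ₗ[ℚ] ℚ) (hf : ∀ n : ℕ, f (X ^ n) = 1)
    (Δ : Polynomial ℚ →ₗ[ℚ] Polynomial ℚ ⊗[ℚ] Polynomial ℚ)
    (hΔ : ∀ n : ℕ, Δ (X ^ n) = ((n.factorial : ℚ))⁻¹ • ((X ^ n) ⊗ₜ[ℚ] (X ^ n))) :
    IsRepresentativeFormQX f ∧
    (∀ n : ℕ,
      ((TensorProduct.lift ((LinearMap.mul ℚ ℚ).compl₁₂ f f)) ∘ₗ Δ) (X ^ n)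
        = ((n.factorial : ℚ))⁻¹) ∧
    ¬ IsRepresentativeFormQX ((TensorProduct.lift ((LinearMap.mul ℚ ℚ).compl₁₂ f f)) ∘ₗ Δ) := by
  have hh : ∀ n : ℕ, ((TensorProduct.lift ((LinearMap.mul ℚ ℚ).compl₁₂ f f)) ∘ₗ Δ) (X ^ n)
      = ((n.factorial : ℚ))⁻¹ := fun n => by simp [hΔ, hf]
  exact ⟨isRepresentativeFormQX_of_map_mul fun p q => by
    simp [apply_eq_eval_one_of_apply_X_pow hf], hh, not_isRepresentativeFormQX_of_apply_X_pow hh⟩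
end

section
/- Let k be a field, B a unital associative k-algebra, and f : B → k a linear form. Then f is a representative linear form (the set of right shifts {x ↦ f(b·x) : b ∈ B} spans a finite-dimensional subspace of the dual of B) if and only if the kernel of f contains a two-sided ideal I of B of finite codimension (i.e. such that the quotient vector space B/I is finite-dimensional over k). -/
/-- If the right shifts of `f` form a finite-dimensional space, then `ker f` contains a
two-sided ideal of finite codimension. -/
theorem exists_ideal_of_finiteDimensional_range_shifts
    {k B : Type*} [Field k] [Ring B] [Algebra k B] (f : B →ₗ[k] k)
    [FiniteDimensional k (LinearMap.range ((LinearMap.mul k B).compr₂ f))] :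
    ∃ I : Submodule k B,
      (∀ a : B, ∀ x ∈ I, a * x ∈ I) ∧ (∀ a : B, ∀ x ∈ I, x * a ∈ I) ∧
      I ≤ LinearMap.ker f ∧ FiniteDimensional k (B ⧸ I) := by
  let L := (LinearMap.mul k B).compr₂ f
  let J := LinearMap.ker L
  have memJ (b : B) : b ∈ J ↔ ∀ x, f (b * x) = 0 := by
    simp [J, L, LinearMap.ext_iff]
  have : FiniteDimensional k (B ⧸ J) := Module.Finite.equiv L.quotKerEquivRange.symm
  have hJ : J ≤ LinearMap.ker ((LinearMap.mul k B).compr₂ J.mkQ) := by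
    intro b hb
    ext a
    simpa [memJ, mul_assoc] using fun x => (memJ b).1 hb (a * x)
  let Φ : B →ₗ[k] (B ⧸ J) →ₗ[k] (B ⧸ J) := (J.liftQ _ hJ).flip
  have memI (a : B) : a ∈ LinearMap.ker Φ ↔ ∀ b x, f (b * a * x) = 0 := by
    rw [LinearMap.mem_ker, LinearMap.ext_iff, J.mkQ_surjective.forall]
    simp [Φ, memJ]
  refine ⟨LinearMap.ker Φ, fun a x hx => ?_, fun a x hx => ?_, fun a ha => ?_,
    Module.Finite.equiv Φ.quotKerEquivRange.symm⟩
  · rw [memI] at hx ⊢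
    intro b y
    simpa [mul_assoc] using hx (b * a) y
  · rw [memI] at hx ⊢
    intro b y
    simpa [mul_assoc] using hx b (a * y)
  · simpa using (memI a).1 ha 1 1


/-- Let `k` be a field, `B` a unital associative `k`-algebra and
`f : B → k` a linear form.  Then `f` is representative (the span of its right shifts
`x ↦ f (b * x)` is finite-dimensional) iff `ker f` contains a two-sided ideal of finite
codimension (a `k`-subspace `I` with `B·I ⊆ I`, `I·B ⊆ I` and `B ⧸ I` finite-dimensional). -/
theorem representative_iff_kernel_contains_finite_codimension_two_sided_ideal
    {k B : Type*} [Field k] [Ring B] [Algebra k B] (f : B →ₗ[k] k) :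
    FiniteDimensional k
      ↥(Submodule.span k (Set.range fun b : B => f ∘ₗ LinearMap.mulLeft k b)) ↔
    ∃ I : Submodule k B,
      (∀ a : B, ∀ x ∈ I, a * x ∈ I) ∧ (∀ a : B, ∀ x ∈ I, x * a ∈ I) ∧
      I ≤ LinearMap.ker f ∧ FiniteDimensional k (B ⧸ I) := by
  have hspan : Submodule.span k (Set.range fun b : B => f ∘ₗ LinearMap.mulLeft k b) =
      LinearMap.range ((LinearMap.mul k B).compr₂ f) := by
    rw [← Submodule.span_eq (LinearMap.range ((LinearMap.mul k B).compr₂ f))]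
    rfl
  constructor
  · intro h
    rw [hspan] at h
    exact exists_ideal_of_finiteDimensional_range_shifts f
  · rintro ⟨I, hl, -, hI, hfin⟩
    have hle : Submodule.span k (Set.range fun b : B => f ∘ₗ LinearMap.mulLeft k b) ≤
        LinearMap.range I.mkQ.dualMap := by
      rw [Submodule.span_le]
      rintro _ ⟨b, rfl⟩
      refine ⟨I.liftQ (f ∘ₗ LinearMap.mulLeft k b) fun x hx => hI (hl b x hx), ?_⟩
      ext x
      rfl
    exact Submodule.finiteDimensional_of_le hle
end

section
/- Let k be a field, B a unital associative k-algebra, and f : B → k a linear form. Then the kernel of f contains a left ideal of B of finite codimension if and only if the kernel of f contains a two-sided ideal of B of finite codimension. -/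
/-- Left multiplication of `B` on the quotient `B ⧸ I` by a left ideal `I`. -/
def leftMulQuotient {k B : Type*} [Field k] [Ring B] [Algebra k B] (I : Submodule k B)
    (hI : ∀ a : B, ∀ x ∈ I, a * x ∈ I) : B →ₗ[k] Module.End k (B ⧸ I) where
  toFun a := I.mapQ I (LinearMap.mulLeft k a) (hI a)
  map_add' a b := by
    ext x
    exact congrArg Submodule.Quotient.mk (add_mul a b x)
  map_smul' c a := by
    ext x
    exact congrArg Submodule.Quotient.mk (smul_mul_assoc c a x)

theorem mem_ker_leftMulQuotient {k B : Type*} [Field k] [Ring B] [Algebra k B]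
    {I : Submodule k B} (hI : ∀ a : B, ∀ x ∈ I, a * x ∈ I) {a : B} :
    a ∈ LinearMap.ker (leftMulQuotient I hI) ↔ ∀ b : B, a * b ∈ I := by
  rw [LinearMap.mem_ker]
  constructor
  · intro h b
    exact (Submodule.Quotient.mk_eq_zero I).1 (LinearMap.congr_fun h (Submodule.Quotient.mk b))
  · intro h
    ext b
    exact (Submodule.Quotient.mk_eq_zero I).2 (h b)

/-- Let `k` be a field, `B` a unital associative `k`-algebra and
`f : B → k` a linear form.  Then `ker f` contains a left ideal of finite codimension iff
`ker f` contains a two-sided ideal of finite codimension. -/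
theorem kernel_contains_finite_codim_left_ideal_iff_two_sided_ideal
    {k B : Type*} [Field k] [Ring B] [Algebra k B] (f : B →ₗ[k] k) :
    (∃ I : Submodule k B,
      (∀ a : B, ∀ x ∈ I, a * x ∈ I) ∧
      I ≤ LinearMap.ker f ∧ FiniteDimensional k (B ⧸ I)) ↔
    (∃ I : Submodule k B,
      (∀ a : B, ∀ x ∈ I, a * x ∈ I) ∧ (∀ a : B, ∀ x ∈ I, x * a ∈ I) ∧
      I ≤ LinearMap.ker f ∧ FiniteDimensional k (B ⧸ I)) := by
  constructor
  · rintro ⟨I, hI, hf, _⟩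
    refine ⟨LinearMap.ker (leftMulQuotient I hI), ?_, ?_, ?_, ?_⟩
    · intro a x hx
      rw [mem_ker_leftMulQuotient] at hx ⊢
      intro b
      rw [mul_assoc]
      exact hI a _ (hx b)
    · intro a x hx
      rw [mem_ker_leftMulQuotient] at hx ⊢
      intro b
      rw [mul_assoc]
      exact hx (a * b)
    · intro x hx
      rw [mem_ker_leftMulQuotient] at hx
      exact hf (by simpa using hx 1)
    · exact Module.Finite.equiv (leftMulQuotient I hI).quotKerEquivRange.symm
  · rintro ⟨I, hl, -, hf, hfin⟩
    exact ⟨I, hl, hf, hfin⟩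
end

section
/- Let k be a field, B a unital associative k-algebra, and f : B → k a linear form. Then there exist n ∈ ℕ and linear forms g₁,…,gₙ, h₁,…,hₙ : B → k such that f(x·y) = Σ_{i=1}^n gᵢ(x)·hᵢ(y) for all x, y ∈ B (i.e. ᵗm(f) ∈ B* ⊗ B*) if and only if the kernel of f contains a two-sided ideal of B of finite codimension. -/
/-- The left ideal `{x | ∀ y, f (y * x) = 0}`, the largest one contained in the kernel of `f`. -/
def LinearMap.leftIdealCore {k B : Type*} [CommSemiring k] [Semiring B] [Algebra k B]
    (f : B →ₗ[k] k) : Ideal B where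
  carrier := {x | ∀ y, f (y * x) = 0}
  add_mem' hx hy z := by rw [mul_add, map_add, hx, hy, add_zero]
  zero_mem' y := by rw [mul_zero, map_zero]
  smul_mem' a x hx y := by rw [smul_eq_mul, ← mul_assoc, hx]

theorem LinearMap.mem_leftIdealCore {k B : Type*} [CommSemiring k] [Semiring B] [Algebra k B]
    {f : B →ₗ[k] k} {x : B} : x ∈ f.leftIdealCore ↔ ∀ y, f (y * x) = 0 := Iff.rfl

/-- If `f (x * y)` is a finite sum of products of linear forms in `x` and in `y`, then the
largest left ideal in the kernel of `f` has finite codimension. -/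
theorem LinearMap.finiteDimensional_quotient_leftIdealCore {k B ι : Type*} [Field k] [Ring B]
    [Algebra k B] [Fintype ι] {f : B →ₗ[k] k} {g h : ι → (B →ₗ[k] k)}
    (hf : ∀ x y : B, f (x * y) = ∑ i, g i x * h i y) :
    FiniteDimensional k (B ⧸ f.leftIdealCore) := by
  have hle : LinearMap.ker (LinearMap.pi h) ≤ f.leftIdealCore.restrictScalars k := by
    intro x hx y
    rw [hf]
    exact Finset.sum_eq_zero fun i _ => by
      rw [show h i x = 0 from congrFun (LinearMap.mem_ker.mp hx) i, mul_zero]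
  have : FiniteDimensional k (B ⧸ LinearMap.ker (LinearMap.pi h)) :=
    Module.Finite.equiv (LinearMap.pi h).quotKerEquivRange.symm
  have : FiniteDimensional k (B ⧸ f.leftIdealCore.restrictScalars k) :=
    Module.Finite.of_surjective (Submodule.factor hle) (Submodule.factor_surjective hle)
  exact Module.Finite.equiv (Submodule.Quotient.restrictScalarsEquiv k f.leftIdealCore)

/-- A linear form vanishing on a right ideal `I` of finite codimension has a decomposition
`f (x * y) = ∑ i, g i x * h i y`. -/
theorem LinearMap.exists_apply_mul_eq_sum {k B : Type*} [Field k] [Ring B] [Algebra k B]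
    {f : B →ₗ[k] k} {I : Submodule k B} (hI : ∀ a : B, ∀ x ∈ I, x * a ∈ I)
    (hf : I ≤ LinearMap.ker f) [FiniteDimensional k (B ⧸ I)] :
    ∃ (n : ℕ) (g h : Fin n → (B →ₗ[k] k)), ∀ x y : B, f (x * y) = ∑ i, g i x * h i y := by
  let b := Module.finBasis k (B ⧸ I)
  choose c hc using fun i => I.mkQ_surjective (b i)
  refine ⟨_, fun i => b.coord i ∘ₗ I.mkQ, fun i => f ∘ₗ LinearMap.mulLeft k (c i),
    fun x y => ?_⟩
  have hx : x - ∑ i, b.repr (I.mkQ x) i • c i ∈ I := by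
    refine (Submodule.Quotient.mk_eq_zero I).mp ?_
    rw [← Submodule.mkQ_apply, map_sub, map_sum]
    simp only [map_smul, hc]
    rw [b.sum_repr, sub_self]
  have hxy := LinearMap.mem_ker.mp (hf (hI y _ hx))
  rw [sub_mul, map_sub, sub_eq_zero] at hxy
  simp [hxy, Finset.sum_mul]

/-- Let `k` be a field, `B` a unital associative `k`-algebra and
`f : B → k` a linear form.  Then `ᵗm(f) ∈ B* ⊗ B*`, i.e. there are finitely many linear
forms `g₁, …, gₙ, h₁, …, hₙ` with `f (x * y) = ∑ i, gᵢ x * hᵢ y`, iff `ker f` contains a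
two-sided ideal of finite codimension. -/
theorem tensor_decomposition_iff_finite_codim_two_sided_ideal
    {k B : Type*} [Field k] [Ring B] [Algebra k B] (f : B →ₗ[k] k) :
    (∃ (n : ℕ) (g h : Fin n → (B →ₗ[k] k)),
      ∀ x y : B, f (x * y) = ∑ i, g i x * h i y) ↔
    (∃ I : Submodule k B,
      (∀ a : B, ∀ x ∈ I, a * x ∈ I) ∧ (∀ a : B, ∀ x ∈ I, x * a ∈ I) ∧
      I ≤ LinearMap.ker f ∧ FiniteDimensional k (B ⧸ I)) := by
  constructor
  · rintro ⟨n, g, h, hf⟩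
    have := LinearMap.finiteDimensional_quotient_leftIdealCore hf
    let φ : B →ₐ[k] Module.End k (B ⧸ f.leftIdealCore) := Algebra.lsmul k k (B ⧸ f.leftIdealCore)
    refine ⟨LinearMap.ker φ.toLinearMap, fun a x hx => ?_, fun a x hx => ?_, fun x hx => ?_,
      Module.Finite.equiv φ.toLinearMap.quotKerEquivRange.symm⟩
    · rw [LinearMap.mem_ker, AlgHom.toLinearMap_apply] at hx ⊢
      rw [map_mul, hx, mul_zero]
    · rw [LinearMap.mem_ker, AlgHom.toLinearMap_apply] at hx ⊢
      rw [map_mul, hx, zero_mul]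
    · have h1 : Submodule.Quotient.mk (p := f.leftIdealCore) (x • (1 : B)) = 0 :=
        LinearMap.congr_fun (LinearMap.mem_ker.mp hx) (Submodule.Quotient.mk 1)
      rw [Submodule.Quotient.mk_eq_zero, LinearMap.mem_leftIdealCore] at h1
      simpa using h1 1
  · rintro ⟨I, -, hI, hf, _⟩
    exact LinearMap.exists_apply_mul_eq_sum hI hf
end

section
/- Let k be a field and B a Hopf algebra over k with antipode σ : B → B. If f : B → k is a linear form belonging to Sweedler's dual B° (i.e. there exist n ∈ ℕ and linear forms g₁,…,gₙ, h₁,…,hₙ : B → k with f(x·y) = Σ_{i=1}^n gᵢ(x)·hᵢ(y) for all x, y ∈ B), then f ∘ σ also belongs to B°; in other words ᵗσ(B°) ⊆ B°. -/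
/-- Let `k` be a field and `B` a Hopf algebra over `k` with antipode `σ`.
If `f : B → k` belongs to Sweedler's dual `B°` (i.e. `f (x * y) = ∑ i, gᵢ x * hᵢ y` for
finitely many linear forms `gᵢ, hᵢ`), then `f ∘ σ` also belongs to `B°`:
`ᵗσ(B°) ⊆ B°`. -/
theorem sweedler_dual_stable_under_antipode
    {k B : Type*} [Field k] [Ring B] [HopfAlgebra k B] (f : B →ₗ[k] k)
    (hf : ∃ (n : ℕ) (g h : Fin n → (B →ₗ[k] k)),
      ∀ x y : B, f (x * y) = ∑ i, g i x * h i y) :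
    ∃ (n : ℕ) (g h : Fin n → (B →ₗ[k] k)),
      ∀ x y : B, (f ∘ₗ (HopfAlgebra.antipode (R := k))) (x * y) = ∑ i, g i x * h i y := by
  obtain ⟨n, g, h, hgh⟩ := hf
  refine ⟨n, fun i ↦ h i ∘ₗ HopfAlgebra.antipode k, fun i ↦ g i ∘ₗ HopfAlgebra.antipode k,
    fun x y ↦ ?_⟩
  simp only [LinearMap.comp_apply, HopfAlgebra.antipode_mul_antidistrib, hgh]
  exact Finset.sum_congr rfl fun i _ ↦ mul_comm _ _
end
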